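/- Suppose K has characteristic p > 0 and F is a finite subfield of K with |F| = q. Let A be an F-subspace of K^n. Then the ideal poly(A) of polynomial relations of A is generated by polynomial relations of weak F-Frobenius type (q-polynomials), i.e., by relations of the form Σ_{i=1}^n Σ_{j≥1} c_{ij} λ_i^{q_{ij}}, where c_{ij} ∈ K and each exponent q_{ij} is a power of q. -/

import Mathlib

/-- The ideal `poly(A)` of polynomial relations of a subset `A ⊆ K^n`. -/
def polyIdeal {K : Type*} [Field K] {n : ℕ} (A : Set (Fin n → K)) :
    Ideal (MvPolynomial (Fin n) K) where
  carrier := {f | ∀ a ∈ A, MvPolynomial.eval a f = 0}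
  zero_mem' := by intro a _; simp
  add_mem' := by intro f g hf hg a ha; simp [hf a ha, hg a ha]
  smul_mem' := by intro c f hf a ha; simp [hf a ha]

/-- `f` is of weak `F`-Frobenius type (a `q`-polynomial): a finite sum
`Σ_i Σ_j c_{ij} λ_i^{q_{ij}}` in which every exponent `q_{ij}` is a power of `q`. -/
def WeakFrobeniusType {K : Type*} [Field K] (q : ℕ) {n : ℕ}
    (f : MvPolynomial (Fin n) K) : Prop :=
  ∃ (N : ℕ) (c : Fin n → Fin N → K) (e : Fin n → Fin N → ℕ),
    f = ∑ i : Fin n, ∑ j : Fin N,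
      MvPolynomial.C (c i j) * MvPolynomial.X i ^ q ^ (e i j)

open MvPolynomial Pointwise in
theorem aux_translate {K : Type*} [Field K] {n : ℕ} (x : Fin n → K) (m : Fin n →₀ ℕ) :
    aeval (fun i => X i + C (x i)) (monomial m (1 : K)) - monomial m (1 : K) ∈
      restrictSupport K (Set.Iio m) := by
  classical
  have key : ∀ m₁ m₂ : Fin n →₀ ℕ,
      aeval (fun i => X i + C (x i)) (monomial m₁ (1 : K)) - monomial m₁ (1 : K) ∈
        restrictSupport K (Set.Iio m₁) →
      aeval (fun i => X i + C (x i)) (monomial m₂ (1 : K)) - monomial m₂ (1 : K) ∈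
        restrictSupport K (Set.Iio m₂) →
      aeval (fun i => X i + C (x i)) (monomial (m₁ + m₂) (1 : K)) - monomial (m₁ + m₂) (1 : K) ∈
        restrictSupport K (Set.Iio (m₁ + m₂)) := by
    intro m₁ m₂ h₁ h₂
    have e : (monomial (m₁ + m₂) (1 : K)) = monomial m₁ 1 * monomial m₂ 1 := by
      rw [monomial_mul, one_mul]
    have e2 : (aeval (fun i => X i + C (x i)) (monomial (m₁ + m₂) (1 : K)) -
        monomial (m₁ + m₂) (1 : K) : MvPolynomial (Fin n) K) =
        (aeval (fun i => X i + C (x i)) (monomial m₁ (1 : K)) - monomial m₁ (1 : K)) *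
        (aeval (fun i => X i + C (x i)) (monomial m₂ (1 : K)) - monomial m₂ (1 : K)) +
        (aeval (fun i => X i + C (x i)) (monomial m₁ (1 : K)) - monomial m₁ (1 : K)) *
          monomial m₂ 1 +
        monomial m₁ 1 *
          (aeval (fun i => X i + C (x i)) (monomial m₂ (1 : K)) - monomial m₂ (1 : K)) := by
      rw [e, map_mul]
      ring
    have hm : ∀ m : Fin n →₀ ℕ, monomial m (1 : K) ∈ restrictSupport K {m} := by
      intro m
      rw [monomial_mem_restrictSupport]
      simp
    have mulmem : ∀ (s t : Set (Fin n →₀ ℕ)) (a b : MvPolynomial (Fin n) K),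
        a ∈ restrictSupport K s → b ∈ restrictSupport K t → s + t ⊆ Set.Iio (m₁ + m₂) →
        a * b ∈ restrictSupport K (Set.Iio (m₁ + m₂)) := by
      intro s t a b ha hb hst
      refine restrictSupport_mono K hst ?_
      rw [restrictSupport_add]
      exact Submodule.mul_mem_mul ha hb
    rw [e2]
    refine Submodule.add_mem _ (Submodule.add_mem _ ?_ ?_) ?_
    · refine mulmem _ _ _ _ h₁ h₂ ?_
      rintro _ ⟨a, ha, b, hb, rfl⟩
      exact add_lt_add (Set.mem_Iio.1 ha) (Set.mem_Iio.1 hb)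
    · refine mulmem _ _ _ _ h₁ (hm _) ?_
      rintro _ ⟨a, ha, b, hb, rfl⟩
      rw [Set.mem_singleton_iff.1 hb]
      exact add_lt_add_left (Set.mem_Iio.1 ha) _
    · refine mulmem _ _ _ _ (hm _) h₂ ?_
      rintro _ ⟨a, ha, b, hb, rfl⟩
      rw [Set.mem_singleton_iff.1 ha]
      exact add_lt_add_right (Set.mem_Iio.1 hb) _
  have h0 : aeval (fun i => X i + C (x i)) (monomial (0 : Fin n →₀ ℕ) (1 : K)) -
      monomial 0 (1 : K) ∈ restrictSupport K (Set.Iio (0 : Fin n →₀ ℕ)) := by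
    have : (monomial (0 : Fin n →₀ ℕ) (1 : K)) = 1 := rfl
    rw [this, map_one, sub_self]
    exact Submodule.zero_mem _
  induction m using Finsupp.induction_linear with
  | zero => exact h0
  | add a b ha hb => exact key a b ha hb
  | single i k =>
    induction k with
    | zero => rw [Finsupp.single_zero]; exact h0
    | succ k ih =>
      rw [Finsupp.single_add]
      refine key _ _ ih ?_
      have : (monomial (Finsupp.single i 1) (1 : K)) = X i := rfl
      rw [this, aeval_X, add_sub_cancel_left]
      change monomial 0 (x i) ∈ _
      rw [monomial_mem_restrictSupport]
      left
      rw [Set.mem_Iio, pos_iff_ne_zero]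
      simp

open MvPolynomial in
theorem aux_translate' {K : Type*} [Field K] {n : ℕ} (x : Fin n → K)
    (f : MvPolynomial (Fin n) K) :
    ∀ k ∈ (aeval (fun i => X i + C (x i)) f - f : MvPolynomial (Fin n) K).support,
      ∃ m ∈ f.support, k < m := by
  suffices h : aeval (fun i => X i + C (x i)) f - f ∈
      restrictSupport K {k | ∃ m ∈ f.support, k < m} from
    fun k hk => ((mem_restrictSupport_iff K).1 h) hk
  have e : aeval (fun i => X i + C (x i)) f - f = ∑ m ∈ f.support, (coeff m f) •
      (aeval (fun i => X i + C (x i)) (monomial m (1 : K)) - monomial m (1 : K)) := by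
    conv_lhs => rw [as_sum f]
    rw [map_sum, ← Finset.sum_sub_distrib]
    refine Finset.sum_congr rfl fun m _ => ?_
    rw [smul_sub, ← map_smul, smul_monomial, smul_eq_mul, mul_one]
  rw [e]
  refine Submodule.sum_mem _ fun m hm => Submodule.smul_mem _ _ ?_
  refine restrictSupport_mono K ?_ (aux_translate x m)
  intro k hk
  exact ⟨m, hm, hk⟩

theorem aux_choose {p : ℕ} (hp : p.Prime) : ∀ k : ℕ, 0 < k →
    (∀ j, 0 < j → j < k → p ∣ k.choose j) → ∃ t, k = p ^ t := by
  intro k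
  induction k using Nat.strong_induction_on with
  | _ k ih =>
    intro hk h
    have := Fact.mk hp
    by_cases h1 : k = 1
    · exact ⟨0, by simp [h1]⟩
    have hd : p ∣ k := by simpa using h 1 one_pos (by omega)
    obtain ⟨k', rfl⟩ := hd
    have hk' : 0 < k' := Nat.pos_of_mul_pos_left hk
    obtain ⟨t, ht⟩ := ih k' (by nlinarith [hp.two_le]) hk' (by
      intro j hj hjk
      have := h (p * j) (Nat.mul_pos hp.pos hj) (Nat.mul_lt_mul_of_pos_left hjk hp.pos)
      have e := Choose.choose_modEq_choose_mod_mul_choose_div_nat (n := p * k') (k := p * j) (p := p)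
      simp only [Nat.mul_mod_right, Nat.choose_self, one_mul, Nat.mul_div_cancel_left _ hp.pos] at e
      exact (e.dvd_iff (dvd_refl p)).1 this)
    exact ⟨t + 1, by rw [ht, pow_succ']⟩

open Polynomial in
theorem aux_additive {K : Type*} [Field K] [Infinite K] {p : ℕ} [CharP K p] (hp : p.Prime)
    (P : K[X]) (h : ∀ x y, P.eval (x + y) = P.eval x + P.eval y) (k : ℕ) (hk : P.coeff k ≠ 0) :
    ∃ t, k = p ^ t := by
  have h0 : P.coeff 0 = 0 := by
    have := h 0 0
    rw [coeff_zero_eq_eval_zero]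
    simpa using this
  have hT : ∀ y, taylor y P = P + C (P.eval y) := by
    intro y
    apply Polynomial.funext
    intro x
    simp [taylor_eval, h]
  have hk0 : 0 < k := by
    rcases Nat.eq_zero_or_pos k with rfl | h'
    · exact absurd h0 hk
    · exact h'
  refine aux_choose hp k hk0 ?_
  intro j hj hjk
  have hH : hasseDeriv j P = C (P.coeff j) := by
    apply Polynomial.funext
    intro y
    rw [← taylor_coeff, hT]
    simp [coeff_C, hj.ne']
  have hc := congrArg (fun Q => coeff Q (k - j)) hH
  simp only [hasseDeriv_coeff, Nat.sub_add_cancel hjk.le, coeff_C, (Nat.sub_pos_of_lt hjk).ne',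
    if_false, mul_eq_zero, hk, or_false] at hc
  exact (CharP.cast_eq_zero_iff K p _).1 hc

open MvPolynomial in
theorem aux_additive_mv {K : Type*} [Field K] [Infinite K] {p : ℕ} [CharP K p] (hp : p.Prime)
    {n : ℕ} (f : MvPolynomial (Fin n) K)
    (h : ∀ x y, eval (x + y) f = eval x f + eval y f) (m : Fin n →₀ ℕ) (hm : m ∈ f.support) :
    ∃ i t, m = Finsupp.single i (p ^ t) := by
  classical
  let P : Fin n → Polynomial K := fun i => aeval (Pi.single i Polynomial.X : Fin n → Polynomial K) f
  have hP : ∀ i (x : K), (P i).eval x = eval (Pi.single i x) f := by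
    intro i x
    have : (Polynomial.aeval x).comp (aeval (Pi.single i Polynomial.X : Fin n → Polynomial K)) =
        (aeval (Pi.single i x : Fin n → K) : MvPolynomial (Fin n) K →ₐ[K] K) := by
      apply MvPolynomial.algHom_ext
      intro j
      by_cases hj : j = i
      · subst hj; simp
      · simp [hj]
    have := DFunLike.congr_fun this f
    simpa [P, Polynomial.aeval_def, Polynomial.eval₂_eq_eval_map, aeval_eq_eval] using this
  have hf : f = ∑ i, Polynomial.aeval (X i : MvPolynomial (Fin n) K) (P i) := by
    apply MvPolynomial.funext
    intro x
    let φ : (Fin n → K) →+ K := AddMonoidHom.mk' (fun x => eval x f) h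
    have : φ x = ∑ i, φ (Pi.single i (x i)) := by
      rw [← map_sum, Finset.univ_sum_single]
    rw [map_sum]
    change φ x = _
    rw [this]
    refine Finset.sum_congr rfl fun i _ => ?_
    change eval _ f = _
    rw [← hP, Polynomial.aeval_def, Polynomial.hom_eval₂, Polynomial.eval]
    congr 1
    · ext; simp
    · simp
  have : ∃ i, coeff m (Polynomial.aeval (X i : MvPolynomial (Fin n) K) (P i)) ≠ 0 := by
    by_contra hcon
    push Not at hcon
    rw [mem_support_iff, hf, coeff_sum] at hm
    exact hm (Finset.sum_eq_zero fun i _ => hcon i)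
  obtain ⟨i, hi⟩ := this
  rw [Polynomial.aeval_eq_sum_range, coeff_sum] at hi
  obtain ⟨k, _, hk⟩ := Finset.exists_ne_zero_of_sum_ne_zero hi
  rw [coeff_smul, coeff_X_pow] at hk
  have hmk : Finsupp.single i k = m := by
    by_contra hne
    simp [hne] at hk
  obtain ⟨t, ht⟩ := aux_additive hp (P i) (by
    intro x y
    rw [hP, hP, hP, Pi.single_add, h]) k (by
      intro h0
      simp [h0] at hk)
  exact ⟨i, t, by rw [← hmk, ht]⟩

theorem aux_pow {F : Type*} [Field F] [Fintype F] {p : ℕ} [CharP F p] (hp : p.Prime) (t : ℕ)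
    (h : ∀ c : F, c ^ p ^ t = c) : ∃ e, p ^ t = Fintype.card F ^ e := by
  obtain ⟨s, _, hs⟩ := FiniteField.card F p
  have h1 : Fintype.card F - 1 ∣ p ^ t - 1 := by
    rw [← FiniteField.forall_pow_eq_one_iff]
    intro x
    have : x * x ^ (p ^ t - 1) = x * 1 := by
      rw [← pow_succ', Nat.sub_add_cancel (Nat.pow_pos hp.pos)]
      ext
      simpa using h x
    exact mul_left_cancel this
  rw [hs] at h1 ⊢
  have h2 := Nat.gcd_eq_left h1
  rw [Nat.pow_sub_one_gcd_pow_sub_one] at h2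
  have h3 : p ^ (Nat.gcd s t) = p ^ (s : ℕ) := by
    have a := Nat.pow_pos (n := Nat.gcd s t) hp.pos
    have b := Nat.pow_pos (n := (s : ℕ)) hp.pos
    omega
  have h4 := Nat.pow_right_injective hp.two_le h3
  obtain ⟨e, he⟩ := Nat.gcd_eq_left_iff_dvd.1 h4
  exact ⟨e, by rw [he, pow_mul]⟩

open MvPolynomial in
theorem aux_wft {K : Type*} [Field K] {q n : ℕ} (hq : 1 < q) (f : MvPolynomial (Fin n) K)
    (h : ∀ m ∈ f.support, ∃ i e, m = Finsupp.single i (q ^ e)) : WeakFrobeniusType q f := by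
  classical
  refine ⟨f.totalDegree + 1, fun i j => coeff (Finsupp.single i (q ^ (j : ℕ))) f,
    fun _ j => j, ?_⟩
  rw [← Fintype.sum_prod_type' (f := fun (i : Fin n) (j : Fin (f.totalDegree + 1)) =>
    C (coeff (Finsupp.single i (q ^ (j : ℕ))) f) * X i ^ q ^ (j : ℕ))]
  let g : Fin n × Fin (f.totalDegree + 1) → (Fin n →₀ ℕ) :=
    fun x => Finsupp.single x.1 (q ^ (x.2 : ℕ))
  have hg : Function.Injective g := by
    rintro ⟨i, j⟩ ⟨i', j'⟩ he
    rcases (Finsupp.single_eq_single_iff _ _ _ _).1 he with h1 | h1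
    · have := Nat.pow_right_injective hq h1.2
      ext
      · exact congrArg _ h1.1
      · exact this
    · exact absurd h1.1 (pow_pos (by omega) _).ne'
  have e1 : ∀ x : Fin n × Fin (f.totalDegree + 1),
      C (coeff (Finsupp.single x.1 (q ^ (x.2 : ℕ))) f) * X x.1 ^ q ^ (x.2 : ℕ) =
      monomial (g x) (coeff (g x) f) := by
    intro x
    rw [X_pow_eq_monomial, C_mul_monomial, mul_one]
  rw [Finset.sum_congr rfl fun x _ => e1 x]
  rw [← Finset.sum_image (g := g) (s := Finset.univ) (f := fun m => monomial m (coeff m f))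
    (fun _ _ _ _ h => hg h)]
  conv_lhs => rw [as_sum f]
  refine Finset.sum_subset ?_ ?_
  · intro m hm
    obtain ⟨i, e, rfl⟩ := h m hm
    rw [Finset.mem_image]
    refine ⟨(i, ⟨e, ?_⟩), Finset.mem_univ _, rfl⟩
    have := le_totalDegree hm
    rw [Finsupp.sum_single_index rfl] at this
    have := Nat.lt_pow_self hq (n := e)
    omega
  · intro m _ hm
    simp [notMem_support_iff.1 hm]

open MvPolynomial in
theorem aux_root {K : Type*} [Field K] [IsAlgClosed K] {p : ℕ} [CharP K p] (hp : p.Prime)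
    {n : ℕ} (f : MvPolynomial (Fin n) K)
    (h : ∀ m ∈ f.support, ∃ m', m = p • m') :
    ∃ g : MvPolynomial (Fin n) K, g ^ p = f ∧ ∀ m ∈ g.support, p • m ∈ f.support := by
  classical
  have := Fact.mk hp
  choose! r hr using h
  choose s hs using fun a : K => IsAlgClosed.exists_pow_nat_eq a hp.pos
  refine ⟨∑ m ∈ f.support, monomial (r m) (s (coeff m f)), ?_, ?_⟩
  · rw [sum_pow_char p]
    conv_rhs => rw [as_sum f]
    refine Finset.sum_congr rfl fun m hm => ?_
    rw [monomial_pow, hs, ← hr m hm]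
  · intro m hm
    rw [mem_support_iff, coeff_sum] at hm
    obtain ⟨k, hk, hk'⟩ := Finset.exists_ne_zero_of_sum_ne_zero hm
    rw [coeff_monomial] at hk'
    have : r k = m := by
      by_contra hne
      simp [hne] at hk'
    rw [← this, ← hr k hk]
    exact hk

open MvPolynomial in
theorem aux_main {K : Type*} [Field K] [IsAlgClosed K] {p : ℕ} [CharP K p] (hp : p.Prime)
    (F : Subfield K) [Fintype F] {q : ℕ} (hq : Fintype.card F = q)
    {n : ℕ} (A : Set (Fin n → K))
    (h0 : (0 : Fin n → K) ∈ A)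
    (hadd : ∀ x ∈ A, ∀ y ∈ A, x + y ∈ A)
    (hsmul : ∀ (c : F), ∀ x ∈ A, (c : K) • x ∈ A)
    (S : Set (Fin n →₀ ℕ)) (hS : IsLowerSet S)
    (hW : ∀ f ∈ polyIdeal A, WeakFrobeniusType q f → (∀ m ∈ f.support, m ∈ S) → f = 0) (d : ℕ) :
    ∀ f ∈ polyIdeal A, (∀ m ∈ f.support, m ∈ S) → (∀ m ∈ f.support, m.degree < d) → f = 0 := by
  classical
  have : Infinite K := IsAlgClosed.instInfinite
  induction d with
  | zero =>
    intro f _ _ hd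
    by_contra hf
    obtain ⟨m, hm⟩ := support_nonempty.2 hf
    exact absurd (hd m hm) (by omega)
  | succ d ih =>
    intro f hfI hfS hfd
    by_contra hf
    obtain ⟨m₀, hm₀⟩ := support_nonempty.2 hf
    have hS0 : (0 : Fin n →₀ ℕ) ∈ S := hS zero_le (hfS m₀ hm₀)
    -- `0` is not in the support
    have hc0 : coeff 0 f = 0 := by
      have := hfI 0 h0
      rwa [← constantCoeff_eq, ← eval_zero]
    have hsupp0 : ∀ m ∈ f.support, m ≠ 0 := by
      rintro m hm rfl
      exact mem_support_iff.1 hm hc0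
    have hdeg_lt : ∀ k m : Fin n →₀ ℕ, k < m → k.degree < m.degree := by
      intro k m hkm
      obtain ⟨r, rfl⟩ := exists_add_of_le hkm.le
      have hr : r ≠ 0 := by
        rintro rfl
        simp at hkm
      rw [map_add]
      have := (Finsupp.degree_eq_zero_iff r).not.2 hr
      omega
    have hd1 : 0 < d := by
      have h1 := hfd m₀ hm₀
      have := (Finsupp.degree_eq_zero_iff m₀).not.2 (hsupp0 m₀ hm₀)
      omega
    let T : (Fin n → K) → MvPolynomial (Fin n) K := fun x => aeval (fun i => X i + C (x i)) f
    have hT : ∀ x y, eval y (T x) = eval (y + x) f := by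
      intro x y
      have : (aeval y).comp (aeval (fun i => X i + C (x i))) =
          (aeval (y + x) : MvPolynomial (Fin n) K →ₐ[K] K) := by
        apply MvPolynomial.algHom_ext
        intro j
        simp [aeval_eq_eval]
      have := DFunLike.congr_fun this f
      simpa [T, aeval_eq_eval] using this
    have htrans : ∀ a ∈ A, ∀ y, eval (y + a) f = eval y f := by
      intro a ha y
      have : T a - f = 0 := by
        apply ih
        · intro b hb
          rw [map_sub, hT, hfI _ (hadd b hb a ha), hfI b hb, sub_zero]
        · intro k hk
          obtain ⟨m, hm, hkm⟩ := aux_translate' a f k hk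
          exact hS hkm.le (hfS m hm)
        · intro k hk
          obtain ⟨m, hm, hkm⟩ := aux_translate' a f k hk
          have := hdeg_lt k m hkm
          have := hfd m hm
          omega
      rw [← hT, sub_eq_zero.1 this]
    have hadditive : ∀ x y, eval (x + y) f = eval x f + eval y f := by
      intro y x
      have hs : ∀ k ∈ (T x - f - C (eval x f)).support, k = 0 ∨ ∃ m ∈ f.support, k < m := by
        intro k hk
        by_cases hk0 : k = 0
        · exact Or.inl hk0
        right
        apply aux_translate' x f k
        rw [mem_support_iff] at hk ⊢
        rw [coeff_sub, coeff_C, if_neg (Ne.symm hk0), sub_zero] at hk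
        exact hk
      have : T x - f - C (eval x f) = 0 := by
        apply ih
        · intro b hb
          rw [map_sub, map_sub, hT, hfI b hb, eval_C, add_comm b x, htrans b hb x]
          simp
        · intro k hk
          rcases hs k hk with rfl | ⟨m, hm, hkm⟩
          · exact hS0
          · exact hS hkm.le (hfS m hm)
        · intro k hk
          rcases hs k hk with rfl | ⟨m, hm, hkm⟩
          · simpa using hd1
          · have := hdeg_lt k m hkm
            have := hfd m hm
            omega
      have := congrArg (eval y) this
      rw [map_sub, map_sub, hT, eval_C, map_zero] at this
      linear_combination this
    -- homogeneity
    have hhom : ∀ c : F, ∀ m ∈ f.support, (c : K) ^ m.degree = (c : K) ^ d := by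
      intro c
      let h : MvPolynomial (Fin n) K :=
        ∑ m ∈ f.support, monomial m (((c : K) ^ m.degree - (c : K) ^ d) * coeff m f)
      have hcoeff : ∀ m, coeff m h = ((c : K) ^ m.degree - (c : K) ^ d) * coeff m f := by
        intro m
        simp only [h, coeff_sum, coeff_monomial, Finset.sum_ite_eq']
        split_ifs with hm
        · rfl
        · rw [notMem_support_iff.1 hm, mul_zero]
      have heval : ∀ a, eval a h = eval ((c : K) • a) f - (c : K) ^ d * eval a f := by
        intro a
        rw [eval_eq ((c : K) • a) f, eval_eq a f, Finset.mul_sum, ← Finset.sum_sub_distrib]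
        simp only [h, map_sum]
        refine Finset.sum_congr rfl fun m _ => ?_
        rw [eval_monomial, Finsupp.prod]
        simp only [Pi.smul_apply, smul_eq_mul, mul_pow, Finset.prod_mul_distrib,
          Finset.prod_pow_eq_pow_sum]
        rw [Finsupp.degree_apply]
        ring
      have hh : h = 0 := by
        apply ih
        · intro a ha
          rw [heval, hfI a ha, hfI _ (hsmul c a ha)]
          simp
        · intro m hm
          apply hfS
          rw [mem_support_iff, hcoeff] at hm
          exact mem_support_iff.2 (right_ne_zero_of_mul hm)
        · intro m hm
          rw [mem_support_iff, hcoeff] at hm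
          have h1 := hfd m (mem_support_iff.2 (right_ne_zero_of_mul hm))
          have h2 : m.degree ≠ d := by
            intro e
            rw [e, sub_self, zero_mul] at hm
            exact hm rfl
          omega
      intro m hm
      have := hcoeff m
      rw [hh, coeff_zero] at this
      rcases mul_eq_zero.1 this.symm with h1 | h1
      · exact sub_eq_zero.1 h1
      · exact absurd h1 (mem_support_iff.1 hm)
    have hshape := aux_additive_mv hp f hadditive
    -- a linear term occurs
    have hlin : ∃ i, Finsupp.single i 1 ∈ f.support := by
      by_contra hcon
      push Not at hcon
      obtain ⟨g, hg, hgs⟩ := aux_root hp f (by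
        intro m hm
        obtain ⟨i, t, rfl⟩ := hshape m hm
        cases t with
        | zero => exact absurd (by simpa using hm) (hcon i)
        | succ t => exact ⟨Finsupp.single i (p ^ t), by simp [pow_succ']⟩)
      have hg0 : g = 0 := by
        apply ih
        · intro a ha
          have := hfI a ha
          rw [← hg, map_pow] at this
          exact pow_eq_zero_iff hp.ne_zero |>.1 this
        · intro m hm
          refine hS ?_ (hfS _ (hgs m hm))
          exact le_self_nsmul zero_le hp.ne_zero
        · intro m hm
          have h1 := hfd _ (hgs m hm)
          have h2 := hsupp0 _ (hgs m hm)
          have h3 : m.degree ≠ 0 := by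
            intro e
            rw [Finsupp.degree_eq_zero_iff] at e
            exact h2 (by simp [e])
          rw [map_nsmul, smul_eq_mul] at h1
          have := hp.two_le
          nlinarith [Nat.pos_of_ne_zero h3]
      rw [hg0, zero_pow hp.ne_zero] at hg
      exact hf hg.symm
    obtain ⟨i₀, hi₀⟩ := hlin
    have hcd : ∀ c : F, (c : K) ^ d = c := by
      intro c
      rw [← hhom c _ hi₀]
      simp
    refine hf (hW f hfI (aux_wft ?_ f ?_) hfS)
    · rw [← hq]
      exact Fintype.one_lt_card
    · intro m hm
      obtain ⟨i, t, rfl⟩ := hshape m hm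
      have : CharP F p := (RingHom.charP_iff F.subtype F.subtype.injective p).2 inferInstance
      obtain ⟨e, he⟩ := aux_pow (F := F) hp t (by
        intro c
        have := hhom c _ hm
        rw [hcd, Finsupp.degree_single] at this
        ext
        simpa using this)
      exact ⟨i, e, by rw [he, hq]⟩

/-- if `K` has characteristic `p > 0` and `F` is a finite subfield with
`|F| = q`, then for any `F`-subspace `A` of `K^n` the ideal `poly(A)` is generated by
polynomial relations of weak `F`-Frobenius type (`q`-polynomials). -/
theorem stmt_16 {K : Type*} [Field K] [IsAlgClosed K] {p : ℕ} [CharP K p] (hp : 0 < p)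
    (F : Subfield K) [Fintype F] {q : ℕ} (hq : Fintype.card F = q)
    {n : ℕ} (A : Set (Fin n → K))
    (h0 : (0 : Fin n → K) ∈ A)
    (hadd : ∀ x ∈ A, ∀ y ∈ A, x + y ∈ A)
    (hsmul : ∀ (c : F), ∀ x ∈ A, (c : K) • x ∈ A) :
    Ideal.span {f | f ∈ polyIdeal A ∧ WeakFrobeniusType q f} = polyIdeal A := by
  classical
  have hp' : p.Prime := (CharP.char_is_prime_or_zero K p).resolve_right hp.ne'
  apply le_antisymm
  · rw [Ideal.span_le]
    exact fun f hf => hf.1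
  intro f hf
  let B : Set (MvPolynomial (Fin n) K) := {f | f ∈ polyIdeal A ∧ WeakFrobeniusType q f ∧ f ≠ 0}
  let M : MonomialOrder (Fin n) := MonomialOrder.lex
  obtain ⟨g, r, hfr, -, hr⟩ := M.div_set (B := B) (fun b hb =>
    IsUnit.mk0 _ (M.leadingCoeff_ne_zero_iff.2 hb.2.2)) f
  have hsum : Finsupp.linearCombination (MvPolynomial (Fin n) K)
      (fun b : B => (b : MvPolynomial (Fin n) K)) g ∈
      Ideal.span {f | f ∈ polyIdeal A ∧ WeakFrobeniusType q f} := by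
    rw [Finsupp.linearCombination_apply]
    refine Ideal.sum_mem _ fun b _ => ?_
    exact Ideal.mul_mem_left _ _ (Ideal.subset_span ⟨b.2.1, b.2.2.1⟩)
  have hsumI : Finsupp.linearCombination (MvPolynomial (Fin n) K)
      (fun b : B => (b : MvPolynomial (Fin n) K)) g ∈ polyIdeal A :=
    (Ideal.span_le.2 fun f hf => hf.1) hsum
  have hrI : r ∈ polyIdeal A := by
    have : r = f - Finsupp.linearCombination (MvPolynomial (Fin n) K)
      (fun b : B => (b : MvPolynomial (Fin n) K)) g := by rw [hfr]; ring
    rw [this]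
    exact Ideal.sub_mem _ hf hsumI
  have hr0 : r = 0 := by
    refine aux_main hp' F hq A h0 hadd hsmul {c | ∀ b ∈ B, ¬ M.degree b ≤ c} ?_ ?_
      (r.support.sup Finsupp.degree + 1) r hrI hr ?_
    · intro a b hba ha c hc hcb
      exact ha c hc (hcb.trans hba)
    · intro h hI hw hS
      by_contra hne
      exact hS _ (M.degree_mem_support hne) h ⟨hI, hw, hne⟩ le_rfl
    · intro m hm
      exact Nat.lt_succ_of_le (Finset.le_sup (f := Finsupp.degree) hm)
  rw [hfr, hr0, add_zero]
  exact hsum
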